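/- arXiv:1811.11417 — 3 statements merged into one kernel-verified Lean document; each statement's English description precedes it below -/
import Mathlib

section
/- In the i.i.d. single-winner setting with n ≥ 2 candidates, let f be the common type distribution on T, x a symmetric interim rule, t* ∈ T a type, and 0 ≤ q < f(t*). Let (f', x') = DecrementSymmetric(n, f, x, t*, q). Then for every set S ⊆ T with t* ∈ S: σ_{n,f',x'}(S) = σ_{n,f,x}(S) / (1 − q)^n. Consequently, the symmetric Border constraint for S is satisfied (respectively, tight) for (f', x') if and only if it is for (f, x). -/
/-!
Statement 16: In the i.i.d. single-winner setting with `n ≥ 2` candidates, let `f` be the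
common type distribution on `T`, `x` a symmetric interim rule, `t* ∈ T` a type, and
`0 ≤ q < f t*` (with `f t* < 1`).  Let `(f', x') = DecrementSymmetric(n, f, x, t*, q)`.
Then for every set `S ⊆ T` with `t* ∈ S`:
`σ_{n,f',x'}(S) = σ_{n,f,x}(S) / (1 − q)^n`.  Consequently, the symmetric Border
constraint for `S` is satisfied (resp. tight) for `(f', x')` iff it is for `(f, x)`.

The symmetric slack of `S` is
`σ_{n,f,x}(S) = 1 − (1 − Σ_{t∈S} f t)^n − n · Σ_{t∈S} f t * x t`.
-/

open Finset

namespace Stmt16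

variable {T : Type} [Fintype T] [DecidableEq T]

/-- The symmetric slack. -/
def slackSym (n : ℕ) (f : T → ℝ) (x : T → ℝ) (S : Finset T) : ℝ :=
  1 - (1 - ∑ t ∈ S, f t) ^ n - (n : ℝ) * ∑ t ∈ S, f t * x t

/-- The prior produced by `DecrementSymmetric(n, f, x, t*, q)`. -/
noncomputable def decFSym (f : T → ℝ) (tstar : T) (q : ℝ) : T → ℝ := fun t =>
  if t = tstar then (f tstar - q) / (1 - q) else f t / (1 - q)

/-- The interim rule produced by `DecrementSymmetric(n, f, x, t*, q)`. -/
noncomputable def decXSym (n : ℕ) (f : T → ℝ) (x : T → ℝ) (tstar : T) (q : ℝ) :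
    T → ℝ := fun t =>
  if t = tstar then
    (f tstar * x tstar - (1 - (1 - q) ^ n) / n) / ((f tstar - q) * (1 - q) ^ (n - 1))
  else x t / (1 - q) ^ (n - 1)

theorem decrement_symmetric_slack
    (n : ℕ) (hn : 2 ≤ n) (T : Type) [Fintype T] [DecidableEq T]
    (f : T → ℝ) (hf0 : ∀ t, 0 ≤ f t) (hf1 : ∑ t : T, f t = 1)
    (x : T → ℝ) (hx : ∀ t, 0 ≤ x t ∧ x t ≤ 1)
    (tstar : T) (hflt : f tstar < 1)
    (q : ℝ) (hq0 : 0 ≤ q) (hq1 : q < f tstar) :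
    ∀ S : Finset T, tstar ∈ S →
      (slackSym n (decFSym f tstar q) (decXSym n f x tstar q) S
          = slackSym n f x S / (1 - q) ^ n) ∧
      ((0 ≤ slackSym n (decFSym f tstar q) (decXSym n f x tstar q) S
          ↔ 0 ≤ slackSym n f x S) ∧
        (slackSym n (decFSym f tstar q) (decXSym n f x tstar q) S = 0
          ↔ slackSym n f x S = 0)) := by
  intro S hS
  have h1 : 0 < 1 - q := by linarith
  have hne : (1 - q) ≠ 0 := h1.ne'
  have hfq : f tstar - q ≠ 0 := (sub_pos.mpr hq1).ne'
  have hP : 0 < (1 - q) ^ n := pow_pos h1 n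
  have hn0 : (n : ℝ) ≠ 0 := by
    have : n ≠ 0 := by omega
    exact_mod_cast this
  have hpow : (1 - q) * (1 - q) ^ (n - 1) = (1 - q) ^ n := by
    rw [← pow_succ']
    congr 1
    omega
  have key : slackSym n (decFSym f tstar q) (decXSym n f x tstar q) S
      = slackSym n f x S / (1 - q) ^ n := by
    have hF : ∑ t ∈ S, decFSym f tstar q t = (∑ t ∈ S, f t - q) / (1 - q) := by
      rw [← Finset.add_sum_erase S _ hS, ← Finset.add_sum_erase S f hS]
      have : ∑ t ∈ S.erase tstar, decFSym f tstar q t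
          = (∑ t ∈ S.erase tstar, f t) / (1 - q) := by
        rw [Finset.sum_div]
        refine Finset.sum_congr rfl fun t ht => ?_
        simp [decFSym, Finset.ne_of_mem_erase ht]
      rw [this]
      simp only [decFSym, if_true]
      ring
    have hX : ∑ t ∈ S, decFSym f tstar q t * decXSym n f x tstar q t
        = (∑ t ∈ S, f t * x t - (1 - (1 - q) ^ n) / n) / (1 - q) ^ n := by
      rw [← Finset.add_sum_erase S _ hS, ← Finset.add_sum_erase S (fun t => f t * x t) hS]
      have : ∑ t ∈ S.erase tstar, decFSym f tstar q t * decXSym n f x tstar q t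
          = (∑ t ∈ S.erase tstar, f t * x t) / (1 - q) ^ n := by
        rw [Finset.sum_div]
        refine Finset.sum_congr rfl fun t ht => ?_
        simp only [decFSym, decXSym, Finset.ne_of_mem_erase ht, if_false]
        rw [div_mul_div_comm, hpow]
      rw [this]
      have h2 : decFSym f tstar q tstar * decXSym n f x tstar q tstar
          = (f tstar * x tstar - (1 - (1 - q) ^ n) / n) / (1 - q) ^ n := by
        simp only [decFSym, decXSym, if_true]
        rw [div_mul_div_comm, mul_left_comm (1 - q), hpow, mul_div_mul_left _ _ hfq]
      rw [h2]
      ring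
    have hG : 1 - (∑ t ∈ S, f t - q) / (1 - q) = (1 - ∑ t ∈ S, f t) / (1 - q) := by
      field_simp
      ring
    unfold slackSym
    rw [hF, hX, hG, div_pow]
    have hP' := hP.ne'
    field_simp
    ring
  refine ⟨key, ?_, ?_⟩
  · rw [key, le_div_iff₀ hP, zero_mul]
  · rw [key, div_eq_zero_iff]
    simp [hP.ne']

end Stmt16
end

section
/- Consider a single-winner environment with n candidates, independent priors f_1, …, f_n on disjoint finite type sets T_1, …, T_n, and finite-faced dice D_{i,t} (one die per candidate i and type t ∈ T_i). Let V_{i} denote the random score of candidate i, obtained by drawing its type t ~ f_i and then rolling D_{i,t}, and consider the dice-based rule in which the candidate with the highest positive score wins, with ties among the highest-scoring candidates broken uniformly at random (no winner if all scores are nonpositive). Then the interim rule implemented by this rule satisfies, for every candidate i and type t ∈ T_i: x_i(t) = Σ_{u ∈ supp(D_{i,t}), u > 0} Pr[D_{i,t} = u] · ( Π_{i'≠i} Pr[V_{i'} ≤ u] ) · Σ_{k=0}^{n−1} B_{i,u}(k)/(k+1), where B_{i,u} is the probability mass function of the Poisson binomial distribution with the n−1 parameters ( Pr[V_{i'} =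 u] / Pr[V_{i'} ≤ u] )_{i'≠i}. -/
/-!
Statement 17: In a single-winner environment with `n` candidates, independent priors on
disjoint finite type sets, and finite-faced dice (one die per type), the interim rule
implemented by the dice-based rule (highest positive score wins, ties among the
highest-scoring candidates broken uniformly at random, no winner if all scores are
nonpositive) is given, for every candidate `i` and type `t` of `i`, by
`x_i(t) = Σ_{u ∈ supp(D_{i,t}), u > 0} Pr[D_{i,t} = u] · (Π_{i'≠i} Pr[V_{i'} ≤ u])
            · Σ_{k=0}^{n−1} B_{i,u}(k)/(k+1)`,
where `V_{i'}` is the random score of candidate `i'` and `B_{i,u}` is the Poisson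
binomial pmf with the `n − 1` parameters `Pr[V_{i'} = u] / Pr[V_{i'} ≤ u]` (`i' ≠ i`).

Formalization conventions: candidates `Fin n`; all types form the finite type `T` with
owner map `cand`; `U : Finset ℝ` is a common finite set containing all faces of all dice,
and die of type `t` is given by its face probabilities `w t : ℝ → ℝ`, supported on `U`.
The sum over the support of `D_{i,t}` intersected with `(0, ∞)` is written as a sum over
the positive faces in `U` (faces of probability zero contribute zero to either side).
-/

open Finset

namespace Stmt17

variable {n : ℕ} {T : Type} [Fintype T] [DecidableEq T]

/-- Valid type profiles. -/
def profiles (cand : T → Fin n) : Finset (Fin n → T) :=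
  Finset.univ.filter fun p => ∀ i, cand (p i) = i

/-- Probability that candidate `i` rolls the face `u`:
`Pr[V_i = u] = Σ_{t : cand t = i} f t * w t u`. -/
def faceProb (cand : T → Fin n) (f : T → ℝ) (w : T → ℝ → ℝ) (i : Fin n) (u : ℝ) : ℝ :=
  ∑ t ∈ Finset.univ.filter (fun t => cand t = i), f t * w t u

/-- `Pr[V_i ≤ u]`, the CDF of candidate `i`'s score at `u`. -/
noncomputable def cdf (cand : T → Fin n) (f : T → ℝ) (w : T → ℝ → ℝ) (U : Finset ℝ)
    (i : Fin n) (u : ℝ) : ℝ :=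
  ∑ u' ∈ U.filter (fun u' => u' ≤ u), faceProb cand f w i u'

/-- The Poisson binomial pmf `B_{i,u}(k)` with parameters
`Pr[V_{i'} = u] / Pr[V_{i'} ≤ u]` for `i' ≠ i`. -/
noncomputable def poissonBinomial (cand : T → Fin n) (f : T → ℝ) (w : T → ℝ → ℝ)
    (U : Finset ℝ) (i : Fin n) (u : ℝ) (k : ℕ) : ℝ :=
  ∑ K ∈ (Finset.univ.erase i).powerset.filter (fun K => K.card = k),
    (∏ i' ∈ K, faceProb cand f w i' u / cdf cand f w U i' u) *
      ∏ i' ∈ (Finset.univ.erase i) \ K,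
        (1 - faceProb cand f w i' u / cdf cand f w U i' u)

/-- Probability that candidate `i` wins given the score vector `s`: `1 / #ties` if `i`'s
score is positive and maximal, and `0` otherwise. -/
noncomputable def tieWin (s : Fin n → ℝ) (i : Fin n) : ℝ :=
  if 0 < s i ∧ ∀ j, s j ≤ s i then
    ((Finset.univ.filter (fun j => s j = s i)).card : ℝ)⁻¹
  else 0

/-- The interim rule implemented by the dice-based rule: the conditional probability that
candidate `i` wins given that its type is `t`. -/
noncomputable def diceInterim (cand : T → Fin n) (f : T → ℝ) (w : T → ℝ → ℝ)
    (U : Finset ℝ) (t : T) : ℝ :=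
  ∑ p ∈ (profiles cand).filter (fun p => p (cand t) = t),
    (∏ j ∈ Finset.univ.erase (cand t), f (p j)) *
      ∑ s ∈ Fintype.piFinset (fun _ : Fin n => U),
        (∏ j : Fin n, w (p j) (s j)) * tieWin s (cand t)

/-- Condition that score `x` of `j` is compatible with winning score `u` and tie set `K`. -/
def tieCond (i : Fin n) (u : ℝ) (K : Finset (Fin n)) (j : Fin n) (x : ℝ) : Prop :=
  if j = i ∨ j ∈ K then x = u else x < u

open Classical in
lemma tieWin_eq (U : Finset ℝ) (i : Fin n) (s : Fin n → ℝ) (hs : ∀ j, s j ∈ U) :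
    tieWin s i = ∑ u ∈ U.filter (fun u => 0 < u), ∑ K ∈ (Finset.univ.erase i).powerset,
      ((K.card : ℝ) + 1)⁻¹ * ∏ j, (if tieCond i u K j (s j) then (1 : ℝ) else 0) := by
  have key : ∀ u K, (∏ j, (if tieCond i u K j (s j) then (1 : ℝ) else 0)) =
      if ∀ j, tieCond i u K j (s j) then 1 else 0 := by
    intro u K
    rw [Finset.prod_ite_zero]
    simp
  simp only [key]
  have hu : ∀ u K, (∀ j, tieCond i u K j (s j)) → u = s i := by
    intro u K h
    have := h i
    simp [tieCond] at this
    exact this.symm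
  have hK : ∀ u, ∀ K ∈ (Finset.univ.erase i).powerset, (∀ j, tieCond i u K j (s j)) →
      K = (Finset.univ.erase i).filter (fun j => s j = s i) := by
    intro u K hKs h
    have h0 := hu u K h
    subst h0
    rw [Finset.mem_powerset] at hKs
    ext j
    have hj := h j
    simp only [tieCond] at hj
    simp only [Finset.mem_filter, Finset.mem_erase, Finset.mem_univ, and_true]
    constructor
    · intro hjK
      have := hKs hjK
      simp at this
      simp [hjK] at hj
      exact ⟨this, hj⟩
    · rintro ⟨h1, h2⟩
      by_contra h3
      simp [h1, h3] at hj
      linarith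
  have hle : ∀ u K, (∀ j, tieCond i u K j (s j)) → ∀ j, s j ≤ s i := by
    intro u K h j
    have h0 := hu u K h
    have hj := h j
    simp only [tieCond] at hj
    split_ifs at hj
    · rw [hj, h0]
    · rw [← h0]; exact hj.le
  unfold tieWin
  split_ifs with hc
  · rw [Finset.sum_eq_single (s i), Finset.sum_eq_single
      ((Finset.univ.erase i).filter (fun j => s j = s i))]
    · rw [if_pos, mul_one]
      · congr 1
        have : Finset.univ.filter (fun j => s j = s i) =
            insert i ((Finset.univ.erase i).filter (fun j => s j = s i)) := by
          ext j
          by_cases hj : j = i <;> simp [hj]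
        rw [this, Finset.card_insert_of_notMem (by simp)]
        push_cast; ring
      · intro j
        simp only [tieCond]
        split_ifs with h
        · rcases h with h | h
          · rw [h]
          · exact (Finset.mem_filter.1 h).2
        · simp at h
          exact lt_of_le_of_ne (hc.2 j) (h.2 h.1)
    · intro K hKm hne
      rw [if_neg, mul_zero]
      exact fun h => hne (hK _ K hKm h)
    · intro h
      exact absurd (Finset.mem_powerset.2 (Finset.filter_subset _ _)) h
    · intro u _ hne
      refine Finset.sum_eq_zero fun K _ => ?_
      rw [if_neg, mul_zero]
      exact fun h => hne (hu _ K h)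
    · intro h
      exact absurd (Finset.mem_filter.2 ⟨hs i, hc.1⟩) h
  · symm
    refine Finset.sum_eq_zero fun u hum => Finset.sum_eq_zero fun K _ => ?_
    rw [if_neg, mul_zero]
    intro h
    apply hc
    refine ⟨?_, hle u K h⟩
    rw [← hu u K h]
    exact (Finset.mem_filter.1 hum).2

/-- Score law of `j` conditional on candidate `cand t` having type `t`. -/
noncomputable def condFace (cand : T → Fin n) (f : T → ℝ) (w : T → ℝ → ℝ) (t : T)
    (j : Fin n) (x : ℝ) : ℝ :=
  if j = cand t then w t x else faceProb cand f w j x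

lemma diceInterim_eq (cand : T → Fin n) (f : T → ℝ) (w : T → ℝ → ℝ) (U : Finset ℝ) (t : T) :
    diceInterim cand f w U t = ∑ s ∈ Fintype.piFinset (fun _ : Fin n => U),
      (∏ j, condFace cand f w t j (s j)) * tieWin s (cand t) := by
  unfold diceInterim
  simp only [Finset.mul_sum]
  rw [Finset.sum_comm]
  refine Finset.sum_congr rfl fun s _ => ?_
  simp only [← mul_assoc]
  rw [← Finset.sum_mul]
  congr 1
  have hset : (profiles cand).filter (fun p => p (cand t) = t) =
      Fintype.piFinset (fun j => if j = cand t then {t} else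
        Finset.univ.filter (fun τ => cand τ = j)) := by
    ext p
    simp only [profiles, Finset.mem_filter, Finset.mem_univ, true_and, Fintype.mem_piFinset]
    constructor
    · rintro ⟨h1, h2⟩ j
      split_ifs with h
      · simp [h, h2]
      · simp [h1 j]
    · intro h
      have h2 : p (cand t) = t := by simpa using h (cand t)
      refine ⟨fun j => ?_, h2⟩
      by_cases hj : j = cand t
      · rw [hj, h2]
      · simpa [hj] using h j
  have hprod : ∀ p : Fin n → T, (∏ j ∈ Finset.univ.erase (cand t), f (p j)) *
      (∏ j, w (p j) (s j)) =
      ∏ j, ((if j = cand t then 1 else f (p j)) * w (p j) (s j)) := by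
    intro p
    rw [Finset.prod_mul_distrib]
    congr 1
    rw [← Finset.mul_prod_erase Finset.univ _ (Finset.mem_univ (cand t))]
    simp only [if_true, one_mul]
    refine Finset.prod_congr rfl fun j hj => ?_
    rw [if_neg (Finset.ne_of_mem_erase hj)]
  simp only [hprod]
  rw [hset, ← Finset.prod_univ_sum (fun j => if j = cand t then {t} else
        Finset.univ.filter (fun τ => cand τ = j))
        (fun j τ => (if j = cand t then 1 else f τ) * w τ (s j))]
  refine Finset.prod_congr rfl fun j _ => ?_
  unfold condFace faceProb
  split_ifs with h <;> simp

open Classical in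
lemma score_sum (U : Finset ℝ) (i : Fin n) (g : Fin n → ℝ → ℝ) :
    ∑ s ∈ Fintype.piFinset (fun _ : Fin n => U), (∏ j, g j (s j)) * tieWin s i =
    ∑ u ∈ U.filter (fun u => 0 < u), ∑ K ∈ (Finset.univ.erase i).powerset,
      ((K.card : ℝ) + 1)⁻¹ * ∏ j, ∑ x ∈ U, (if tieCond i u K j x then g j x else 0) := by
  have h1 : ∀ s ∈ Fintype.piFinset (fun _ : Fin n => U), (∏ j, g j (s j)) * tieWin s i =
      ∑ u ∈ U.filter (fun u => 0 < u), ∑ K ∈ (Finset.univ.erase i).powerset,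
      ((K.card : ℝ) + 1)⁻¹ * ∏ j, (if tieCond i u K j (s j) then g j (s j) else 0) := by
    intro s hs
    rw [tieWin_eq U i s (Fintype.mem_piFinset.1 hs)]
    simp only [Finset.mul_sum]
    refine Finset.sum_congr rfl fun u _ => Finset.sum_congr rfl fun K _ => ?_
    rw [mul_left_comm, ← Finset.prod_mul_distrib]
    simp
  rw [Finset.sum_congr rfl h1, Finset.sum_comm]
  refine Finset.sum_congr rfl fun u _ => ?_
  rw [Finset.sum_comm]
  refine Finset.sum_congr rfl fun K _ => ?_
  rw [← Finset.mul_sum, Finset.prod_univ_sum (fun _ => U)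
    (fun j x => if tieCond i u K j x then g j x else 0)]

theorem dice_to_interim
    (n : ℕ) (T : Type) [Fintype T] [DecidableEq T]
    (cand : T → Fin n) (f : T → ℝ)
    (hf0 : ∀ t, 0 ≤ f t)
    (hf1 : ∀ i : Fin n, ∑ t ∈ Finset.univ.filter (fun t => cand t = i), f t = 1)
    (U : Finset ℝ) (w : T → ℝ → ℝ)
    (hw0 : ∀ t u, 0 ≤ w t u)
    (hw1 : ∀ t, ∑ u ∈ U, w t u = 1)
    (hwsupp : ∀ t (u : ℝ), u ∉ U → w t u = 0) :
    ∀ t : T,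
      diceInterim cand f w U t =
        ∑ u ∈ U.filter (fun u => 0 < u),
          w t u * (∏ i' ∈ Finset.univ.erase (cand t), cdf cand f w U i' u) *
            ∑ k ∈ Finset.range n, poissonBinomial cand f w U (cand t) u k / (k + 1) := by
  classical
  intro t
  rw [diceInterim_eq, score_sum]
  refine Finset.sum_congr rfl fun u hu => ?_
  have huU : u ∈ U := (Finset.mem_filter.1 hu).1
  have hfp : ∀ j x, 0 ≤ faceProb cand f w j x := fun j x =>
    Finset.sum_nonneg fun τ _ => mul_nonneg (hf0 τ) (hw0 τ x)
  have hle : ∀ j, faceProb cand f w j u ≤ cdf cand f w U j u := fun j =>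
    Finset.single_le_sum (f := fun x => faceProb cand f w j x) (fun x _ => hfp j x)
      (Finset.mem_filter.2 ⟨huU, le_rfl⟩)
  have hlt : ∀ j, ∑ x ∈ U, (if x < u then faceProb cand f w j x else 0) =
      cdf cand f w U j u - faceProb cand f w j u := by
    intro j
    have : U.filter (fun x => x ≤ u) = insert u (U.filter (fun x => x < u)) := by
      ext x
      simp only [Finset.mem_filter, Finset.mem_insert, le_iff_lt_or_eq]
      constructor
      · rintro ⟨h0, h | h⟩
        · exact Or.inr ⟨h0, h⟩
        · exact Or.inl h
      · rintro (h | h)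
        · exact ⟨h ▸ huU, Or.inr h⟩
        · exact ⟨h.1, Or.inl h.2⟩
    rw [cdf, this, Finset.sum_insert (by simp), Finset.sum_filter]
    ring
  have hA : ∀ j, cdf cand f w U j u * (faceProb cand f w j u / cdf cand f w U j u) =
      faceProb cand f w j u := by
    intro j
    by_cases hc : cdf cand f w U j u = 0
    · have h1 := hle j
      have h2 := hfp j u
      rw [hc] at h1 ⊢
      rw [zero_mul]; linarith
    · field_simp
  -- the Poisson binomial expectation
  have hB : ∑ k ∈ Finset.range n, poissonBinomial cand f w U (cand t) u k / ((k : ℝ) + 1) =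
      ∑ K ∈ (Finset.univ.erase (cand t)).powerset,
      ((K.card : ℝ) + 1)⁻¹ * ((∏ i' ∈ K, faceProb cand f w i' u / cdf cand f w U i' u) *
      ∏ i' ∈ (Finset.univ.erase (cand t)) \ K,
        (1 - faceProb cand f w i' u / cdf cand f w U i' u)) := by
    have hm : ∀ K ∈ (Finset.univ.erase (cand t)).powerset, K.card ∈ Finset.range n := by
      intro K hK
      have h1 : K ⊂ Finset.univ := lt_of_le_of_lt (Finset.mem_powerset.1 hK)
        (Finset.erase_ssubset (Finset.mem_univ _))
      have := Finset.card_lt_card h1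
      simpa using this
    rw [← Finset.sum_fiberwise_of_maps_to hm]
    refine Finset.sum_congr rfl fun k _ => ?_
    rw [poissonBinomial, Finset.sum_div]
    refine Finset.sum_congr rfl fun K hK => ?_
    rw [(Finset.mem_filter.1 hK).2, div_eq_mul_inv, mul_comm]
  rw [hB, Finset.mul_sum]
  refine Finset.sum_congr rfl fun K hK => ?_
  have hKs := Finset.mem_powerset.1 hK
  rw [← Finset.mul_prod_erase Finset.univ _ (Finset.mem_univ (cand t)),
    ← Finset.prod_sdiff hKs, ← Finset.prod_sdiff hKs]
  have e0 : ∑ x ∈ U, (if tieCond (cand t) u K (cand t) x then condFace cand f w t (cand t) x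
      else 0) = w t u := by
    simp [tieCond, condFace, huU]
  have e1 : ∏ j ∈ K, ∑ x ∈ U, (if tieCond (cand t) u K j x then condFace cand f w t j x
      else 0) = (∏ j ∈ K, cdf cand f w U j u) *
        ∏ j ∈ K, faceProb cand f w j u / cdf cand f w U j u := by
    rw [← Finset.prod_mul_distrib]
    refine Finset.prod_congr rfl fun j hj => ?_
    have hne := Finset.ne_of_mem_erase (hKs hj)
    rw [hA]
    simp [tieCond, condFace, huU, hj, hne]
  have e2 : ∏ j ∈ (Finset.univ.erase (cand t)) \ K,
      ∑ x ∈ U, (if tieCond (cand t) u K j x then condFace cand f w t j x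
      else 0) = (∏ j ∈ (Finset.univ.erase (cand t)) \ K, cdf cand f w U j u) *
        ∏ j ∈ (Finset.univ.erase (cand t)) \ K,
          (1 - faceProb cand f w j u / cdf cand f w U j u) := by
    rw [← Finset.prod_mul_distrib]
    refine Finset.prod_congr rfl fun j hj => ?_
    have hne := Finset.ne_of_mem_erase (Finset.mem_sdiff.1 hj).1
    have hj2 := (Finset.mem_sdiff.1 hj).2
    rw [mul_sub, hA, mul_one, ← hlt]
    simp [tieCond, condFace, hj2, hne]
  rw [e0, e1, e2]
  ring

end Stmt17
end

section
/- Consider the winner-selection environment with four candidates 1, 2, 3, 4, each having a single (deterministic) type, where the feasible winner sets are exactly {1,2}, {3,4}, all singletons, and the empty set (a non-matroid feasibility constraint). Then every feasible interim rule x = (x(1), x(2), x(3), x(4)) ∈ [0,1]^4 within this environment admits a dice-based implementation: there exist dice D_1, D_2, D_3, D_4 (probability distributions on ℝ ∪ {−∞}) such that the rule selecting a feasible set maximizing the sum of the independently rolled scores (where candidates rolling −∞ are excluded) implements x. -/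
/-!
Statement 19: Consider the winner-selection environment with four candidates `0,1,2,3`
(named 1–4 in the paper), each with a single deterministic type, and feasible winner sets
exactly `{0,1}`, `{2,3}`, all singletons, and `∅` (not a matroid).  Every feasible
interim rule `x ∈ [0,1]^4` — i.e., one implementable by some distribution over the
feasible sets — admits a dice-based implementation: there exist dice `D_0, …, D_3`
(probability distributions on `ℝ ∪ {−∞} = EReal` without `+∞` mass) and a selection rule
`W` mapping each score vector to a feasible set that maximizes the sum of scores among
feasible sets containing no candidate who rolled `−∞` (and never contains such a
candidate), such that `Pr[i ∈ W(s)] = x i` for every candidate `i` when the scores `s`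
are rolled independently from the dice.
-/

open MeasureTheory Finset

namespace Stmt19

/-- The feasible winner sets. -/
def Feas : Finset (Finset (Fin 4)) :=
  {∅, {0}, {1}, {2}, {3}, {0, 1}, {2, 3}}

/-- `x` is a feasible interim rule: some distribution `y` over the feasible sets gives
each candidate `i` winning probability `x i`. -/
def FeasibleInterim (x : Fin 4 → ℝ) : Prop :=
  ∃ y : Finset (Fin 4) → ℝ,
    (∀ S, 0 ≤ y S) ∧ (∀ S, y S ≠ 0 → S ∈ Feas) ∧
    (∑ S : Finset (Fin 4), y S = 1) ∧
    ∀ i : Fin 4, ∑ S ∈ Finset.univ.filter (fun S : Finset (Fin 4) => i ∈ S), y S = x i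

theorem feas_add_le (x : Fin 4 → ℝ) (hfeas : FeasibleInterim x) (a c : Fin 4)
    (hac : ∀ S ∈ Feas, ¬ (a ∈ S ∧ c ∈ S)) : x a + x c ≤ 1 := by
  obtain ⟨y, h0, hF, h1, hy⟩ := hfeas
  rw [← hy a, ← hy c, ← h1, Finset.sum_filter, Finset.sum_filter, ← Finset.sum_add_distrib]
  refine Finset.sum_le_sum fun S _ => ?_
  by_cases hS : y S = 0
  · simp [hS]
  · have := hac S (hF S hS)
    have := h0 S
    split_ifs <;> first | (exfalso; tauto) | linarith

/-- The requirement on the chosen winner set at score vector `s`. -/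
def Good (s : Fin 4 → EReal) (S : Finset (Fin 4)) : Prop :=
  S ∈ Feas ∧ (∀ i ∈ S, s i ≠ ⊥) ∧
    ∀ T ∈ Feas, (∀ i ∈ T, s i ≠ ⊥) → ∑ i ∈ T, s i ≤ ∑ i ∈ S, s i

theorem exists_good (s : Fin 4 → EReal) : ∃ S, Good s S := by
  classical
  obtain ⟨S, hS, hm⟩ := Finset.exists_max_image
    (Feas.filter fun T => ∀ i ∈ T, s i ≠ ⊥) (fun T => ∑ i ∈ T, s i)
    ⟨∅, by simp [Feas]⟩
  rw [Finset.mem_filter] at hS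
  exact ⟨S, hS.1, hS.2, fun T h1 h2 => hm T (Finset.mem_filter.2 ⟨h1, h2⟩)⟩

/-- The value of each die (when not bottom). -/
noncomputable def val (a c i : Fin 4) : EReal := if i = a then 2 else if i = c then 1 else 0

def Ord (a b c d : Fin 4) : Prop :=
  ((a = 0 ∧ b = 1) ∨ (a = 1 ∧ b = 0)) ∧ ((c = 2 ∧ d = 3) ∨ (c = 3 ∧ d = 2))

set_option maxHeartbeats 4000000 in
theorem exists_good_supp (a b c d : Fin 4) (h : Ord a b c d) (s : Fin 4 → EReal)
    (hs : ∀ i, s i = val a c i ∨ s i = ⊥) :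
    ∃ S, Good s S ∧ (a ∈ S ↔ s a = 2) ∧ (b ∈ S ↔ s a = 2 ∧ s b = 0) ∧
      (c ∈ S ↔ s a = ⊥ ∧ s c = 1) ∧ (d ∈ S ↔ s a = ⊥ ∧ s c = 1 ∧ s d = 0) := by
  have h21 : (1 : EReal) ≤ 2 := by exact_mod_cast (by norm_num : (1:ℝ) ≤ 2)
  have hb2 : (⊥ : EReal) ≠ 2 := by
    intro h
    have : (⊥ : EReal) = ((2:ℝ) : EReal) := h
    exact EReal.bot_ne_coe _ this
  have h2b := hb2.symm
  have hb1 : (1 : EReal) ≠ ⊥ := EReal.coe_ne_bot 1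
  have h1b := hb1.symm
  have h0 := hs 0
  have h1 := hs 1
  have h2 := hs 2
  have h3 := hs 3
  refine ⟨if s a = 2 then (if s b = 0 then {a, b} else {a}) else
    if s c = 1 then (if s d = 0 then {c, d} else {c}) else ∅, ?_⟩
  obtain ⟨⟨rfl, rfl⟩ | ⟨rfl, rfl⟩, ⟨rfl, rfl⟩ | ⟨rfl, rfl⟩⟩ := h <;>
  simp [val] at h0 h1 h2 h3 <;>
  rcases h0 with h0 | h0 <;> rcases h1 with h1 | h1 <;> rcases h2 with h2 | h2 <;>
  rcases h3 with h3 | h3 <;>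
  simp [Good, Feas, h0, h1, h2, h3, h21, hb2, h2b, hb1, h1b, Finset.pair_comm]

/-- Two-point die. -/
noncomputable def die (p : ℝ) (v : EReal) : Measure EReal :=
  ENNReal.ofReal p • Measure.dirac v + ENNReal.ofReal (1 - p) • Measure.dirac ⊥

theorem die_prob (p : ℝ) (v : EReal) (h0 : 0 ≤ p) (h1 : p ≤ 1) :
    IsProbabilityMeasure (die p v) := by
  constructor
  simp [die]
  rw [← ENNReal.ofReal_add h0 (by linarith)]
  simp

theorem die_val (p : ℝ) (v : EReal) (hv : v ≠ ⊥) : die p v {v} = ENNReal.ofReal p := by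
  simp [die, hv.symm]

theorem die_bot (p : ℝ) (v : EReal) (hv : v ≠ ⊥) :
    die p v {⊥} = ENNReal.ofReal (1 - p) := by
  simp [die, hv]

theorem die_top (p : ℝ) (v : EReal) (hv : v ≠ ⊤) : die p v {⊤} = 0 := by
  simp [die, hv]

theorem die_ae (p : ℝ) (v : EReal) : ∀ᵐ t ∂(die p v), t = v ∨ t = ⊥ := by
  have : MeasurableSet {t : EReal | t = v ∨ t = ⊥}ᶜ :=
    ((measurableSet_singleton v).union (measurableSet_singleton ⊥)).compl
  rw [ae_iff]
  change die p v {t : EReal | t = v ∨ t = ⊥}ᶜ = 0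
  simp [die, this]

theorem core (x : Fin 4 → ℝ)
    (hx : ∀ i, 0 ≤ x i ∧ x i ≤ 1) (a b c d : Fin 4) (h : Ord a b c d)
    (hab : x b ≤ x a) (hcd : x d ≤ x c) (hac : x a + x c ≤ 1) :
    ∃ D : Fin 4 → Measure EReal,
      (∀ i, IsProbabilityMeasure (D i)) ∧ (∀ i, D i {⊤} = 0) ∧
      ∃ W : (Fin 4 → EReal) → Finset (Fin 4),
        (∀ s, W s ∈ Feas) ∧
        (∀ s, ∀ i ∈ W s, s i ≠ ⊥) ∧
        (∀ s, ∀ S ∈ Feas, (∀ i ∈ S, s i ≠ ⊥) →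
          ∑ i ∈ S, s i ≤ ∑ i ∈ W s, s i) ∧
        ∀ i : Fin 4,
          ((Measure.pi D) {s : Fin 4 → EReal | i ∈ W s}).toReal = x i := by
  classical
  have hW : ∀ s : Fin 4 → EReal, ∃ S, Good s S ∧ ((∀ i, s i = val a c i ∨ s i = ⊥) →
      (a ∈ S ↔ s a = 2) ∧ (b ∈ S ↔ s a = 2 ∧ s b = 0) ∧
      (c ∈ S ↔ s a = ⊥ ∧ s c = 1) ∧ (d ∈ S ↔ s a = ⊥ ∧ s c = 1 ∧ s d = 0)) := by
    intro s
    by_cases hs : ∀ i, s i = val a c i ∨ s i = ⊥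
    · obtain ⟨S, h1, h2⟩ := exists_good_supp a b c d h s hs
      exact ⟨S, h1, fun _ => h2⟩
    · obtain ⟨S, h1⟩ := exists_good s
      exact ⟨S, h1, fun h => absurd h hs⟩
  choose W hW using hW
  let p : Fin 4 → ℝ := fun i => if i = a then x a else if i = b then x b / x a else
    if i = c then x c / (1 - x a) else x d / x c
  have hp : ∀ i, 0 ≤ p i ∧ p i ≤ 1 := by
    intro i
    have ha := hx a
    have hb := hx b
    have hc := hx c
    have hd := hx d
    simp only [p]
    split_ifs
    · exact ha
    · exact ⟨div_nonneg hb.1 ha.1, div_le_one_of_le₀ hab ha.1⟩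
    · exact ⟨div_nonneg hc.1 (by linarith), div_le_one_of_le₀ (by linarith) (by linarith)⟩
    · exact ⟨div_nonneg hd.1 hc.1, div_le_one_of_le₀ hcd hc.1⟩
  have hvb : ∀ i, val a c i ≠ ⊥ := by
    intro i
    have : (2 : EReal) ≠ ⊥ := EReal.coe_ne_bot 2
    simp only [val]
    have h1 : (1 : EReal) ≠ ⊥ := EReal.coe_ne_bot 1
    split_ifs <;> simp [this, h1]
  have hvt : ∀ i, val a c i ≠ ⊤ := by
    intro i
    have : (2 : EReal) ≠ ⊤ := EReal.coe_ne_top 2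
    have : (1 : EReal) ≠ ⊤ := EReal.coe_ne_top 1
    simp only [val]
    split_ifs <;> simp [*]
  let D : Fin 4 → Measure EReal := fun i => die (p i) (val a c i)
  have hD : ∀ i, IsProbabilityMeasure (D i) := fun i => die_prob _ _ (hp i).1 (hp i).2
  refine ⟨D, hD, fun i => die_top _ _ (hvt i), W, fun s => (hW s).1.1,
    fun s => (hW s).1.2.1, fun s => (hW s).1.2.2, ?_⟩
  have hae : ∀ᵐ s ∂(Measure.pi D), ∀ i, s i = val a c i ∨ s i = ⊥ := by
    rw [ae_all_iff]
    intro i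
    exact (Measure.quasiMeasurePreserving_eval D i).ae (die_ae (p i) (val a c i))
  have key : ∀ (i : Fin 4) (t : Fin 4 → Set EReal),
      (∀ s, (∀ i, s i = val a c i ∨ s i = ⊥) → (i ∈ W s ↔ ∀ j, s j ∈ t j)) →
      ((Measure.pi D) {s : Fin 4 → EReal | i ∈ W s}).toReal = ∏ j, (D j (t j)).toReal := by
    intro i t hit
    have : {s : Fin 4 → EReal | i ∈ W s} =ᵐ[Measure.pi D] Set.pi Set.univ t := by
      filter_upwards [hae] with s hs
      apply propext
      have := hit s hs
      change i ∈ W s ↔ s ∈ Set.pi Set.univ t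
      simpa using this
    rw [measure_congr this, Measure.pi_pi, ENNReal.toReal_prod]
  have dv : ∀ i, (D i {val a c i}).toReal = p i := by
    intro i
    simp only [D]
    rw [die_val _ _ (hvb i), ENNReal.toReal_ofReal (hp i).1]
  have db : ∀ i, (D i {⊥}).toReal = 1 - p i := by
    intro i
    simp only [D]
    rw [die_bot _ _ (hvb i), ENNReal.toReal_ofReal (by linarith [(hp i).2])]
  have du : ∀ i, (D i Set.univ).toReal = 1 := by
    intro i
    simp
  have nab : b ≠ a ∧ c ≠ a ∧ d ≠ a ∧ c ≠ b ∧ d ≠ b ∧ d ≠ c := by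
    obtain ⟨⟨rfl, rfl⟩ | ⟨rfl, rfl⟩, ⟨rfl, rfl⟩ | ⟨rfl, rfl⟩⟩ := h <;> decide
  obtain ⟨ba, ca, da, cb, db', dc⟩ := nab
  have hall : ∀ P : Fin 4 → Prop, (∀ j, P j) ↔ P a ∧ P b ∧ P c ∧ P d := by
    intro P
    obtain ⟨⟨rfl, rfl⟩ | ⟨rfl, rfl⟩, ⟨rfl, rfl⟩ | ⟨rfl, rfl⟩⟩ := h <;>
      rw [Fin.forall_fin_succ, Fin.forall_fin_succ, Fin.forall_fin_succ, Fin.forall_fin_succ] <;>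
      simp <;> tauto
  have hprod : ∀ f : Fin 4 → ℝ, ∏ j, f j = f a * f b * f c * f d := by
    intro f
    obtain ⟨⟨rfl, rfl⟩ | ⟨rfl, rfl⟩, ⟨rfl, rfl⟩ | ⟨rfl, rfl⟩⟩ := h <;>
      rw [Fin.prod_univ_four] <;> ring
  have va : val a c a = 2 := by simp [val]
  have vb : val a c b = 0 := by simp [val, ba, cb.symm]
  have vc : val a c c = 1 := by simp [val, ca]
  have vd : val a c d = 0 := by simp [val, da, dc]
  have pa : p a = x a := by simp [p]
  have pb : p b = x b / x a := by simp [p, ba]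
  have pc : p c = x c / (1 - x a) := by simp [p, ca, cb]
  have pd : p d = x d / x c := by simp [p, da, db', dc]
  let t : Set EReal → Set EReal → Set EReal → Set EReal → Fin 4 → Set EReal :=
    fun A B C E j => if j = a then A else if j = b then B else if j = c then C else E
  have ta : ∀ A B C E, t A B C E a = A := by intros; simp [t]
  have tb : ∀ A B C E, t A B C E b = B := by intros; simp [t, ba]
  have tc : ∀ A B C E, t A B C E c = C := by intros; simp [t, ca, cb]
  have td : ∀ A B C E, t A B C E d = E := by intros; simp [t, da, db', dc]
  have hA := (hx a)
  have hC := (hx c)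
  have e2 : x a * (x b / x a) = x b := by
    by_cases h0 : x a = 0
    · have := (hx b).1
      rw [h0] at hab ⊢
      simp; linarith
    · field_simp
  have e3 : (1 - x a) * (x c / (1 - x a)) = x c := by
    by_cases h0 : 1 - x a = 0
    · rw [h0]
      simp; linarith
    · field_simp
  have e4 : x c * (x d / x c) = x d := by
    by_cases h0 : x c = 0
    · have := (hx d).1
      rw [h0] at hcd ⊢
      simp; linarith
    · field_simp
  rw [hall]
  refine ⟨?_, ?_, ?_, ?_⟩
  · rw [key a (t {val a c a} Set.univ Set.univ Set.univ), hprod, ta, tb, tc, td, dv, du, du, du, pa]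
    · ring
    · intro s hs
      rw [((hW s).2 hs).1, hall, ta, tb, tc, td, va]
      simp
  · rw [key b (t {val a c a} {val a c b} Set.univ Set.univ), hprod, ta, tb, tc, td, dv, dv, du, du,
      pa, pb, e2]
    · ring
    · intro s hs
      rw [((hW s).2 hs).2.1, hall, ta, tb, tc, td, va, vb]
      simp
  · rw [key c (t {⊥} Set.univ {val a c c} Set.univ), hprod, ta, tb, tc, td, db, dv, du, du,
      pa, pc, mul_one, mul_one, e3]
    · intro s hs
      rw [((hW s).2 hs).2.2.1, hall, ta, tb, tc, td, vc]
      simp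
  · rw [key d (t {⊥} Set.univ {val a c c} {val a c d}), hprod, ta, tb, tc, td, db, dv, dv, du,
      pa, pc, pd, mul_one, e3, e4]
    · intro s hs
      rw [((hW s).2 hs).2.2.2, hall, ta, tb, tc, td, vc, vd]
      simp

theorem non_matroid_dice_exist (x : Fin 4 → ℝ)
    (hx : ∀ i, 0 ≤ x i ∧ x i ≤ 1) (hfeas : FeasibleInterim x) :
    ∃ D : Fin 4 → Measure EReal,
      (∀ i, IsProbabilityMeasure (D i)) ∧ (∀ i, D i {⊤} = 0) ∧
      ∃ W : (Fin 4 → EReal) → Finset (Fin 4),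
        (∀ s, W s ∈ Feas) ∧
        (∀ s, ∀ i ∈ W s, s i ≠ ⊥) ∧
        (∀ s, ∀ S ∈ Feas, (∀ i ∈ S, s i ≠ ⊥) →
          ∑ i ∈ S, s i ≤ ∑ i ∈ W s, s i) ∧
        ∀ i : Fin 4,
          ((Measure.pi D) {s : Fin 4 → EReal | i ∈ W s}).toReal = x i := by
  have main : ∀ a b c d : Fin 4, Ord a b c d → x a + x c ≤ 1 := by
    intro a b c d h
    apply feas_add_le x hfeas
    obtain ⟨⟨rfl, rfl⟩ | ⟨rfl, rfl⟩, ⟨rfl, rfl⟩ | ⟨rfl, rfl⟩⟩ := h <;> decide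
  rcases le_total (x 1) (x 0) with h1 | h1 <;> rcases le_total (x 3) (x 2) with h2 | h2
  · have o : Ord 0 1 2 3 := by simp [Ord]
    exact core x hx 0 1 2 3 o h1 h2 (main _ _ _ _ o)
  · have o : Ord 0 1 3 2 := by simp [Ord]
    exact core x hx 0 1 3 2 o h1 h2 (main _ _ _ _ o)
  · have o : Ord 1 0 2 3 := by simp [Ord]
    exact core x hx 1 0 2 3 o h1 h2 (main _ _ _ _ o)
  · have o : Ord 1 0 3 2 := by simp [Ord]
    exact core x hx 1 0 3 2 o h1 h2 (main _ _ _ _ o)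

end Stmt19
end
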